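/- There is a universal constant C such that for every metric space (X,d) and every root r ∈ X there exists an online subgraph algorithm A — a function from finite sequences of points of X to finite sets of unordered pairs of points of X with A(s) ⊆ A(s') whenever s is a prefix of s' — such that for every sequence v_1,…,v_k of k ≥ 1 points: (i) d_{A(v_1,…,v_k)}(v_s, r) ≤ 7·d(v_s, r) for every s ∈ {1,…,k} (stretch 7 to the sink), and (ii) d(A(v_1,…,v_k)) ≤ C·(1 + log₂ k)·mst({r, v_1, …, v_k}), where mst(S) denotes the minimum total d-length of a spanning tree of the complete graph on the finite point set S. -/

import Mathlib

open scoped Classical ENNReal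

noncomputable section

variable {X : Type*} [MetricSpace X]

/-- The length of an unordered pair of points: the distance between its endpoints. -/
def edgeLen (e : Sym2 X) : ℝ :=
  Sym2.lift ⟨fun x y => dist x y, fun x y => dist_comm x y⟩ e

/-- The edges of a finite sequence of points: unordered pairs of consecutive points. -/
def edgeList (p : List X) : List (Sym2 X) :=
  (p.zip p.tail).map fun ab => s(ab.1, ab.2)

/-- The cost of a weighted graph (a finite set of unordered pairs of points):
the sum of the lengths of its edges. -/
def graphCost (H : Finset (Sym2 X)) : ℝ :=
  ∑ e ∈ H, edgeLen e

/-- The total length of a finite sequence of points. -/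
def pathLen (p : List X) : ℝ :=
  ((edgeList p).map edgeLen).sum

/-- `p` is a walk from `a` to `b` all of whose edges lie in `H`. -/
def IsWalkIn (H : Set (Sym2 X)) (a b : X) (p : List X) : Prop :=
  p.head? = some a ∧ p.getLast? = some b ∧ ∀ e ∈ edgeList p, e ∈ H

/-- The graph distance between `a` and `b` in the graph `H`: the infimum of the
lengths of walks from `a` to `b` using only edges of `H` (`∞` if there is none). -/
def graphDist (H : Set (Sym2 X)) (a b : X) : ℝ≥0∞ :=
  ⨅ p : { p : List X // IsWalkIn H a b p }, ENNReal.ofReal (pathLen p.1)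

/-- The minimum total length of a spanning tree of the complete graph on the finite
point set `S` (equivalently, since lengths are nonnegative, the minimum cost of a
finite edge set on `S` connecting all points of `S`). -/
def mstCost (S : Finset X) : ℝ :=
  sInf { c | ∃ T : Finset (Sym2 X),
    (∀ e ∈ T, ∀ x ∈ e, x ∈ S) ∧
    (∀ a ∈ S, ∀ b ∈ S, graphDist (↑T) a b ≠ ⊤) ∧
    c = graphCost T }

set_option linter.unusedSectionVars false

/-! ### Graph distance -/

lemma edgeLen_mk (a b : X) : edgeLen s(a, b) = dist a b := rfl

lemma edgeLen_nonneg (e : Sym2 X) : 0 ≤ edgeLen e := by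
  induction e with
  | _ a b => exact dist_nonneg

lemma edgeList_cons_cons (a b : X) (p : List X) :
    edgeList (a :: b :: p) = s(a, b) :: edgeList (b :: p) := rfl

lemma pathLen_cons_cons (a b : X) (p : List X) :
    pathLen (a :: b :: p) = dist a b + pathLen (b :: p) := by
  simp [pathLen, edgeList_cons_cons, edgeLen_mk]

lemma pathLen_nonneg (p : List X) : 0 ≤ pathLen p := by
  refine List.sum_nonneg fun x hx => ?_
  obtain ⟨e, -, rfl⟩ := List.mem_map.1 hx
  exact edgeLen_nonneg e

lemma isWalkIn_singleton (H : Set (Sym2 X)) (a : X) : IsWalkIn H a a [a] := by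
  simp [IsWalkIn, edgeList]

lemma graphDist_self (H : Set (Sym2 X)) (a : X) : graphDist H a a = 0 := by
  refine le_antisymm ((iInf_le _ ⟨[a], isWalkIn_singleton H a⟩).trans ?_) zero_le
  simp [pathLen, edgeList]

lemma graphDist_mono {H K : Set (Sym2 X)} (hHK : H ⊆ K) (a b : X) :
    graphDist K a b ≤ graphDist H a b :=
  le_iInf fun p => iInf_le_of_le ⟨p.1, p.2.1, p.2.2.1, fun e he => hHK (p.2.2.2 e he)⟩ le_rfl

lemma graphDist_le_edge_add {H : Set (Sym2 X)} {a b : X} (hab : s(a, b) ∈ H) (c : X) :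
    graphDist H a c ≤ ENNReal.ofReal (dist a b) + graphDist H b c := by
  rw [graphDist, graphDist, ENNReal.add_iInf]
  refine le_iInf fun p => ?_
  obtain ⟨p, hp⟩ := p
  match p, hp with
  | [], hp => simp [IsWalkIn] at hp
  | x :: q, hp =>
    obtain rfl : x = b := by simpa using hp.1
    refine iInf_le_of_le ⟨a :: x :: q, rfl, by simpa using hp.2.1, ?_⟩ ?_
    · intro e he
      rcases List.mem_cons.1 (edgeList_cons_cons a x q ▸ he) with rfl | he
      · exact hab
      · exact hp.2.2 e he
    · rw [pathLen_cons_cons, ENNReal.ofReal_add dist_nonneg (pathLen_nonneg _)]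

lemma graphDist_edge {H : Set (Sym2 X)} {a b : X} (hab : s(a, b) ∈ H) :
    graphDist H a b ≤ ENNReal.ofReal (dist a b) := by
  simpa [graphDist_self] using graphDist_le_edge_add hab b

lemma graphDist_le_pathLen_add {H : Set (Sym2 X)} (c : X) :
    ∀ {a b : X} (p : List X), IsWalkIn H a b p →
      graphDist H a c ≤ ENNReal.ofReal (pathLen p) + graphDist H b c
  | a, b, [], hp => by simp [IsWalkIn] at hp
  | a, b, [x], hp => by
    obtain rfl : x = a := by simpa using hp.1
    obtain rfl : x = b := by simpa using hp.2.1
    simp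
  | a, b, x :: y :: q, hp => by
    obtain rfl : x = a := by simpa using hp.1
    have hE := hp.2.2
    rw [edgeList_cons_cons] at hE
    have ih := graphDist_le_pathLen_add (H := H) c (a := y) (b := b) (y :: q)
      ⟨rfl, by simpa using hp.2.1, fun e he => hE e (List.mem_cons_of_mem _ he)⟩
    rw [pathLen_cons_cons, ENNReal.ofReal_add dist_nonneg (pathLen_nonneg _), add_assoc]
    exact (graphDist_le_edge_add (hE _ List.mem_cons_self) c).trans (by gcongr)

lemma graphDist_triangle (H : Set (Sym2 X)) (a b c : X) :
    graphDist H a c ≤ graphDist H a b + graphDist H b c := by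
  conv_rhs => rw [graphDist, ENNReal.iInf_add]
  exact le_iInf fun p => graphDist_le_pathLen_add c p.1 p.2

lemma IsWalkIn.reachable {H : Set (Sym2 X)} :
    ∀ {a b : X} (p : List X), IsWalkIn H a b p → (SimpleGraph.fromEdgeSet H).Reachable a b
  | a, b, [], hp => by simp [IsWalkIn] at hp
  | a, b, [x], hp => by
    obtain rfl : x = a := by simpa using hp.1
    obtain rfl : x = b := by simpa using hp.2.1
    rfl
  | a, b, x :: y :: q, hp => by
    obtain rfl : x = a := by simpa using hp.1
    have hE := hp.2.2
    rw [edgeList_cons_cons] at hE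
    have ih := IsWalkIn.reachable (H := H) (a := y) (b := b) (y :: q)
      ⟨rfl, by simpa using hp.2.1, fun e he => hE e (List.mem_cons_of_mem _ he)⟩
    refine SimpleGraph.Reachable.trans ?_ ih
    by_cases hxy : x = y
    · rw [hxy]
    · exact SimpleGraph.Adj.reachable
        ((SimpleGraph.fromEdgeSet_adj H).2 ⟨hE _ List.mem_cons_self, hxy⟩)

lemma reachable_of_graphDist_ne_top {H : Set (Sym2 X)} {a b : X} (h : graphDist H a b ≠ ⊤) :
    (SimpleGraph.fromEdgeSet H).Reachable a b := by
  by_contra hn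
  refine h (iInf_eq_top.2 fun p => ?_)
  exact (hn (IsWalkIn.reachable p.1 p.2)).elim

/-! ### Packing disjoint balls in a connected graph -/

/-- The variation of a function along an unordered pair. -/
def edgeVar (f : X → ℝ) (e : Sym2 X) : ℝ :=
  Sym2.lift ⟨fun x y => |f x - f y|, fun x y => abs_sub_comm (f x) (f y)⟩ e

lemma edgeVar_mk (f : X → ℝ) (a b : X) : edgeVar f s(a, b) = |f a - f b| := rfl

lemma edgeVar_nonneg (f : X → ℝ) (e : Sym2 X) : 0 ≤ edgeVar f e := by
  induction e with
  | _ a b => exact abs_nonneg _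

lemma sub_le_sum_edgeVar_walk (f : X → ℝ) {G : SimpleGraph X} {a b : X} (p : G.Walk a b) :
    f a - f b ≤ (p.edges.map (edgeVar f)).sum := by
  induction p with
  | nil => simp
  | @cons u v w h p ih =>
    rw [SimpleGraph.Walk.edges_cons, List.map_cons, List.sum_cons, edgeVar_mk]
    linarith [le_abs_self (f u - f v)]

lemma sub_le_sum_edgeVar (f : X → ℝ) {E : Finset (Sym2 X)} {a b : X}
    (h : graphDist (↑E) a b ≠ ⊤) : f a - f b ≤ ∑ e ∈ E, edgeVar f e := by
  obtain ⟨p, hp⟩ := (reachable_of_graphDist_ne_top h).exists_isPath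
  refine (sub_le_sum_edgeVar_walk f p).trans ?_
  rw [← List.sum_toFinset _ hp.isTrail.edges_nodup]
  refine Finset.sum_le_sum_of_subset_of_nonneg (fun e he => ?_) fun e _ _ => edgeVar_nonneg f e
  have := p.edges_subset_edgeSet (List.mem_toFinset.1 he)
  rw [SimpleGraph.edgeSet_fromEdgeSet] at this
  exact this.1

/-- The tent functions of radii `ρ h` around pairwise far apart centres `h` have total
variation at most `τ a b` between any two points `a`, `b`. -/
lemma sum_abs_tent_sub_le {P : Finset X} {S : Set X} {τ : X → X → ℝ} {ρ : X → ℝ}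
    (hsymm : ∀ x ∈ S, ∀ y ∈ S, τ x y = τ y x)
    (htri : ∀ x ∈ S, ∀ y ∈ S, ∀ z ∈ S, τ x z ≤ τ x y + τ y z)
    (hPS : ∀ h ∈ P, h ∈ S)
    (hsep : ∀ h ∈ P, ∀ h' ∈ P, h ≠ h' → ρ h + ρ h' ≤ τ h h')
    {a b : X} (ha : a ∈ S) (hb : b ∈ S) (hab : 0 ≤ τ a b) :
    ∑ h ∈ P, |max 0 (ρ h - τ h a) - max 0 (ρ h - τ h b)| ≤ τ a b := by
  have lip : ∀ h ∈ P, |max 0 (ρ h - τ h a) - max 0 (ρ h - τ h b)| ≤ τ a b := by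
    intro h hh
    have h1 := htri h (hPS h hh) a ha b hb
    have h2 := htri h (hPS h hh) b hb a ha
    have h3 := hsymm a ha b hb
    refine (abs_max_sub_max_le_max _ _ _ _).trans ?_
    simp only [sub_self, abs_zero]
    exact max_le hab (abs_le.2 ⟨by linarith, by linarith⟩)
  have uniq : ∀ c ∈ S, ∀ h ∈ P, ∀ h' ∈ P, h' ≠ h → 0 < ρ h - τ h c →
      max 0 (ρ h' - τ h' c) = 0 := by
    intro c hc h hh h' hh' hne hpos
    refine max_eq_left ?_
    have h1 := hsep h' hh' h hh hne
    have h2 := htri h' (hPS h' hh') c hc h (hPS h hh)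
    have h3 := hsymm c hc h (hPS h hh)
    linarith
  by_cases hA : ∃ h ∈ P, 0 < ρ h - τ h a
  · obtain ⟨h₁, hh₁, hpos₁⟩ := hA
    by_cases hB : ∃ h ∈ P, h ≠ h₁ ∧ 0 < ρ h - τ h b
    · obtain ⟨h₂, hh₂, hne, hpos₂⟩ := hB
      rw [Finset.sum_eq_add_of_mem h₁ h₂ hh₁ hh₂ hne.symm]
      · rw [uniq a ha h₁ hh₁ h₂ hh₂ hne hpos₁, uniq b hb h₂ hh₂ h₁ hh₁ hne.symm hpos₂,
          max_eq_right hpos₁.le, max_eq_right hpos₂.le, sub_zero, zero_sub, abs_neg,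
          abs_of_pos hpos₁, abs_of_pos hpos₂]
        have h1 := hsep h₁ hh₁ h₂ hh₂ hne.symm
        have h2 := htri h₁ (hPS _ hh₁) a ha h₂ (hPS _ hh₂)
        have h3 := htri a ha b hb h₂ (hPS _ hh₂)
        have h4 := hsymm b hb h₂ (hPS _ hh₂)
        linarith
      · intro h hh hn
        rw [uniq a ha h₁ hh₁ h hh hn.1 hpos₁, uniq b hb h₂ hh₂ h hh hn.2 hpos₂]
        simp
    · push Not at hB
      rw [Finset.sum_eq_single_of_mem h₁ hh₁]
      · exact lip h₁ hh₁
      · intro h hh hn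
        rw [uniq a ha h₁ hh₁ h hh hn hpos₁, max_eq_left (hB h hh hn)]
        simp
  · push Not at hA
    by_cases hB : ∃ h ∈ P, 0 < ρ h - τ h b
    · obtain ⟨h₂, hh₂, hpos₂⟩ := hB
      rw [Finset.sum_eq_single_of_mem h₂ hh₂]
      · exact lip h₂ hh₂
      · intro h hh hn
        rw [uniq b hb h₂ hh₂ h hh hn hpos₂, max_eq_left (hA h hh)]
        simp
    · push Not at hB
      rw [Finset.sum_eq_zero]
      · exact hab
      · intro h hh
        rw [max_eq_left (hA h hh), max_eq_left (hB h hh)]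
        simp

/-- If balls of radii `ρ h` for a pseudometric `τ` are disjoint and miss `r`, then any graph
whose edges are at least as long as `τ` and which connects the centres to `r` costs at least
the sum of the radii. -/
lemma sum_radius_le_graphCost {P : Finset X} {S : Set X} {τ : X → X → ℝ} {ρ : X → ℝ}
    {E : Finset (Sym2 X)} {r : X}
    (hself : ∀ x ∈ S, τ x x = 0)
    (hsymm : ∀ x ∈ S, ∀ y ∈ S, τ x y = τ y x)
    (htri : ∀ x ∈ S, ∀ y ∈ S, ∀ z ∈ S, τ x z ≤ τ x y + τ y z)
    (hPS : ∀ h ∈ P, h ∈ S)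
    (hsep : ∀ h ∈ P, ∀ h' ∈ P, h ≠ h' → ρ h + ρ h' ≤ τ h h')
    (hroot : ∀ h ∈ P, ρ h ≤ τ h r)
    (hES : ∀ e ∈ E, ∀ x ∈ e, x ∈ S)
    (hlen : ∀ a b, s(a, b) ∈ E → τ a b ≤ dist a b)
    (hconn : ∀ h ∈ P, graphDist (↑E) h r ≠ ⊤) :
    ∑ h ∈ P, ρ h ≤ graphCost E := by
  calc ∑ h ∈ P, ρ h
      ≤ ∑ h ∈ P, ∑ e ∈ E, edgeVar (fun x => max 0 (ρ h - τ h x)) e := by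
        refine Finset.sum_le_sum fun h hh => ?_
        have := sub_le_sum_edgeVar (fun x => max 0 (ρ h - τ h x)) (hconn h hh)
        simp only [hself h (hPS h hh), sub_zero,
          max_eq_left (sub_nonpos.2 (hroot h hh))] at this
        exact (le_max_right 0 (ρ h)).trans this
    _ = ∑ e ∈ E, ∑ h ∈ P, edgeVar (fun x => max 0 (ρ h - τ h x)) e := Finset.sum_comm
    _ ≤ graphCost E := by
        refine Finset.sum_le_sum fun e he => ?_
        induction e with
        | _ a b =>
          have ha := hES _ he a (Sym2.mem_mk_left a b)
          have hb := hES _ he b (Sym2.mem_mk_right a b)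
          have h0 : 0 ≤ τ a b := by
            have := htri a ha b hb a ha
            rw [hself a ha, hsymm b hb a ha] at this
            linarith
          exact (sum_abs_tent_sub_le hsymm htri hPS hsep ha hb h0).trans (hlen a b he)

/-- If the attachment costs `c` satisfy `min (c x) (c y) ≤ dist x y`, their sum over `n` points
is at most `2 H_n` times the cost of any connected graph through these points and `r`. -/
lemma sum_le_harmonic_mul {E : Finset (Sym2 X)} {c : X → ℝ} {r : X} (n : ℕ) (Q : Finset X)
    (hn : Q.card = n)
    (hsep : ∀ x ∈ Q, ∀ y ∈ Q, x ≠ y → min (c x) (c y) ≤ dist x y)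
    (hroot : ∀ x ∈ Q, c x ≤ dist x r)
    (hconn : ∀ x ∈ Q, graphDist (↑E) x r ≠ ⊤) :
    ∑ x ∈ Q, c x ≤ 2 * graphCost E * (harmonic n : ℝ) := by
  induction n generalizing Q with
  | zero => simp [Finset.card_eq_zero.1 hn]
  | succ n ih =>
    obtain ⟨m, hm, hmin⟩ := Q.exists_min_image c (Finset.card_pos.1 (by omega))
    have h1 := ih (Q.erase m) (by rw [Finset.card_erase_of_mem hm, hn]; rfl)
      (fun x hx y hy => hsep x (Finset.mem_of_mem_erase hx) y (Finset.mem_of_mem_erase hy))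
      (fun x hx => hroot x (Finset.mem_of_mem_erase hx))
      (fun x hx => hconn x (Finset.mem_of_mem_erase hx))
    have h2 : ∑ _x ∈ Q, c m / 2 ≤ graphCost E := by
      refine sum_radius_le_graphCost (S := Set.univ) (τ := dist) (r := r)
        (fun x _ => dist_self x) (fun x _ y _ => dist_comm x y)
        (fun x _ y _ z _ => dist_triangle x y z) (fun _ _ => trivial) ?_ ?_
        (fun _ _ _ _ => trivial) (fun _ _ _ => le_rfl) hconn
      · intro x hx y hy hxy
        linarith [hsep x hx y hy hxy, le_min (hmin x hx) (hmin y hy)]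
      · intro x hx
        linarith [hroot x hx, hmin x hx, dist_nonneg (x := x) (y := r)]
    rw [Finset.sum_const, hn, nsmul_eq_mul] at h2
    push_cast at h2
    have h3 : c m ≤ 2 * graphCost E * ((n : ℝ) + 1)⁻¹ := by
      rw [← div_eq_mul_inv, le_div_iff₀ (by positivity)]
      linarith
    rw [← Finset.add_sum_erase Q c hm, harmonic_succ]
    push_cast
    linarith

/-! ### The online algorithm -/

/-- A point of `S` nearest to `v`. -/
def nearest (S : Finset X) (v : X) : X :=
  if h : S.Nonempty then (S.exists_min_image (dist v) h).choose else v

lemma nearest_mem {S : Finset X} (hS : S.Nonempty) (v : X) : nearest S v ∈ S := by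
  rw [nearest, dif_pos hS]
  exact (S.exists_min_image (dist v) hS).choose_spec.1

lemma dist_nearest_le {S : Finset X} {x : X} (hx : x ∈ S) (v : X) :
    dist v (nearest S v) ≤ dist v x := by
  have hS : S.Nonempty := ⟨x, hx⟩
  rw [nearest, dif_pos hS]
  exact (S.exists_min_image (dist v) hS).choose_spec.2 x hx

/-- Extends `τ` to a new leaf `v`, attached to `u` by an edge of length `c`. -/
def leafDist (τ : X → X → ℝ) (u v : X) (c : ℝ) (x y : X) : ℝ :=
  if x = v then (if y = v then 0 else τ u y + c) else (if y = v then τ x u + c else τ x y)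

/-- The state of the algorithm: the vertices seen so far, the greedy tree with its tree distance,
the hubs (vertices joined directly to the sink), and the length of the edge by which every vertex
was attached to the tree. -/
structure LastState (X : Type*) where
  verts : Finset X
  tree : Finset (Sym2 X)
  hubs : Finset X
  treeDist : X → X → ℝ
  attachCost : X → ℝ

namespace LastState

/-- The edges bought by the algorithm. -/
def edges (r : X) (σ : LastState X) : Finset (Sym2 X) :=
  σ.tree ∪ σ.hubs.image fun h => s(h, r)

/-- The state before the first arrival. -/
def start (r : X) : LastState X where
  verts := {r}
  tree := ∅
  hubs := {r}
  treeDist _ _ := 0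
  attachCost _ := 0

/-- A new vertex is attached to its nearest predecessor, and becomes a hub unless some route
through the tree and an old hub has stretch at most `7`. -/
def step (r : X) (σ : LastState X) (v : X) : LastState X :=
  if v ∈ σ.verts then σ else
    let u := nearest σ.verts v
    let τ := leafDist σ.treeDist u v (dist v u)
    { verts := insert v σ.verts
      tree := insert s(v, u) σ.tree
      hubs := if ∃ h ∈ σ.hubs, τ v h + dist h r ≤ 7 * dist v r then σ.hubs else insert v σ.hubs
      treeDist := τ
      attachCost := Function.update σ.attachCost v (dist v u) }

lemma edges_subset_step (r : X) (σ : LastState X) (v : X) :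
    σ.edges r ⊆ (σ.step r v).edges r := by
  unfold step
  split_ifs
  · rfl
  · refine Finset.union_subset_union (Finset.subset_insert _ _) (Finset.image_subset_image ?_)
    dsimp only
    split_ifs
    · rfl
    · exact Finset.subset_insert _ _

lemma verts_step (r : X) (σ : LastState X) (v : X) :
    (σ.step r v).verts = insert v σ.verts := by
  unfold step
  split_ifs with h
  · exact (Finset.insert_eq_of_mem h).symm
  · rfl

/-- The invariant maintained by the algorithm. -/
structure Inv (r : X) (σ : LastState X) : Prop where
  root_mem : r ∈ σ.verts
  self : ∀ x ∈ σ.verts, σ.treeDist x x = 0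
  symm : ∀ x ∈ σ.verts, ∀ y ∈ σ.verts, σ.treeDist x y = σ.treeDist y x
  tri : ∀ x ∈ σ.verts, ∀ y ∈ σ.verts, ∀ z ∈ σ.verts,
    σ.treeDist x z ≤ σ.treeDist x y + σ.treeDist y z
  dist_le : ∀ x ∈ σ.verts, ∀ y ∈ σ.verts, dist x y ≤ σ.treeDist x y
  tree_verts : ∀ e ∈ σ.tree, ∀ x ∈ e, x ∈ σ.verts
  tree_le : ∀ a b, s(a, b) ∈ σ.tree → σ.treeDist a b ≤ dist a b
  graphDist_le : ∀ x ∈ σ.verts, ∀ y ∈ σ.verts,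
    graphDist (↑σ.tree) x y ≤ ENNReal.ofReal (σ.treeDist x y)
  hubs_verts : ∀ h ∈ σ.hubs, h ∈ σ.verts
  hubs_sep : ∀ h ∈ σ.hubs, ∀ h' ∈ σ.hubs, h ≠ h' →
    3 / 8 * dist h r + 3 / 8 * dist h' r ≤ σ.treeDist h h'
  stretch : ∀ x ∈ σ.verts, ∃ h ∈ σ.hubs, σ.treeDist x h + dist h r ≤ 7 * dist x r
  attach_sep : ∀ x ∈ σ.verts.erase r, ∀ y ∈ σ.verts.erase r, x ≠ y →
    min (σ.attachCost x) (σ.attachCost y) ≤ dist x y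
  attach_root : ∀ x ∈ σ.verts.erase r, σ.attachCost x ≤ dist x r
  cost_le : graphCost σ.tree ≤ ∑ x ∈ σ.verts.erase r, σ.attachCost x

lemma inv_start (r : X) : (start r).Inv r := by
  constructor <;> simp [start, graphDist_self, graphCost]

lemma inv_step {r : X} {σ : LastState X} (hσ : σ.Inv r) (v : X) : (σ.step r v).Inv r := by
  by_cases hv : v ∈ σ.verts
  · rwa [step, if_pos hv]
  rw [step, if_neg hv]
  have hu : nearest σ.verts v ∈ σ.verts := nearest_mem ⟨r, hσ.root_mem⟩ v
  have hnear : ∀ x ∈ σ.verts, dist v (nearest σ.verts v) ≤ dist v x :=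
    fun x hx => dist_nearest_le hx v
  generalize nearest σ.verts v = u at hu hnear
  have hc : 0 ≤ dist v u := dist_nonneg
  have ne_v : ∀ x ∈ σ.verts, x ≠ v := fun x hx h => hv (h ▸ hx)
  have hrv : r ≠ v := ne_v r hσ.root_mem
  have nonneg : ∀ x ∈ σ.verts, ∀ y ∈ σ.verts, 0 ≤ σ.treeDist x y :=
    fun x hx y hy => dist_nonneg.trans (hσ.dist_le x hx y hy)
  have τ_vv : leafDist σ.treeDist u v (dist v u) v v = 0 := by simp [leafDist]
  have τ_v : ∀ y ∈ σ.verts,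
      leafDist σ.treeDist u v (dist v u) v y = σ.treeDist u y + dist v u := by
    intro y hy
    simp [leafDist, ne_v y hy]
  have v_τ : ∀ x ∈ σ.verts,
      leafDist σ.treeDist u v (dist v u) x v = σ.treeDist x u + dist v u := by
    intro x hx
    simp [leafDist, ne_v x hx]
  have τ_old : ∀ x ∈ σ.verts, ∀ y ∈ σ.verts,
      leafDist σ.treeDist u v (dist v u) x y = σ.treeDist x y := by
    intro x hx y hy
    simp [leafDist, ne_v x hx, ne_v y hy]
  have old_edge : ∀ e ∈ σ.tree, ∀ x ∈ e, x ≠ v := fun e he x hx =>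
    ne_v x (hσ.tree_verts e he x hx)
  have erase_eq : (insert v σ.verts).erase r = insert v (σ.verts.erase r) :=
    Finset.erase_insert_of_ne hrv.symm
  have dist_le' : ∀ x ∈ σ.verts, dist v x ≤ σ.treeDist u x + dist v u := by
    intro x hx
    linarith [dist_triangle v u x, hσ.dist_le u hu x hx]
  have mono : ∀ x ∈ σ.verts, ∀ y ∈ σ.verts,
      graphDist (↑(insert s(v, u) σ.tree)) x y ≤ ENNReal.ofReal (σ.treeDist x y) :=
    fun x hx y hy => (graphDist_mono (by simp) x y).trans (hσ.graphDist_le x hx y hy)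
  have att : ∀ x ∈ σ.verts,
      Function.update σ.attachCost v (dist v u) x = σ.attachCost x :=
    fun x hx => Function.update_of_ne (ne_v x hx) _ _
  constructor <;> dsimp only
  · exact Finset.mem_insert_of_mem hσ.root_mem
  · refine Finset.forall_mem_insert .. |>.2 ⟨τ_vv, fun x hx => ?_⟩
    rw [τ_old x hx x hx, hσ.self x hx]
  · intro x hx y hy
    rw [Finset.mem_insert] at hx hy
    rcases hx with rfl | hx <;> rcases hy with rfl | hy
    · rfl
    · rw [τ_v y hy, v_τ y hy, hσ.symm u hu y hy]
    · rw [τ_v x hx, v_τ x hx, hσ.symm u hu x hx]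
    · rw [τ_old x hx y hy, τ_old y hy x hx, hσ.symm x hx y hy]
  · intro x hx y hy z hz
    rw [Finset.mem_insert] at hx hy hz
    rcases hx with rfl | hx <;> rcases hy with rfl | hy <;> rcases hz with rfl | hz
    · simp [τ_vv]
    · simp [τ_vv]
    · rw [τ_vv, τ_v y hy, v_τ y hy]
      linarith [nonneg u hu y hy, nonneg y hy u hu]
    · rw [τ_v y hy, τ_v z hz, τ_old y hy z hz]
      linarith [hσ.tri u hu y hy z hz]
    · simp [τ_vv]
    · rw [τ_old x hx z hz, τ_v z hz, v_τ x hx]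
      linarith [hσ.tri x hx u hu z hz]
    · rw [v_τ x hx, τ_old x hx y hy, v_τ y hy]
      linarith [hσ.tri x hx y hy u hu]
    · rw [τ_old x hx y hy, τ_old y hy z hz, τ_old x hx z hz]
      exact hσ.tri x hx y hy z hz
  · intro x hx y hy
    rw [Finset.mem_insert] at hx hy
    rcases hx with rfl | hx <;> rcases hy with rfl | hy
    · simp [τ_vv]
    · rw [τ_v y hy]
      exact dist_le' y hy
    · rw [v_τ x hx, dist_comm, hσ.symm x hx u hu]
      exact dist_le' x hx
    · rw [τ_old x hx y hy]
      exact hσ.dist_le x hx y hy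
  · intro e he x hx
    rw [Finset.mem_insert] at he
    rcases he with rfl | he
    · rcases Sym2.mem_iff.1 hx with rfl | rfl
      · exact Finset.mem_insert_self _ _
      · exact Finset.mem_insert_of_mem hu
    · exact Finset.mem_insert_of_mem (hσ.tree_verts e he x hx)
  · intro a b hab
    rw [Finset.mem_insert] at hab
    rcases hab with h | h
    · rcases Sym2.eq_iff.1 h with ⟨rfl, rfl⟩ | ⟨rfl, rfl⟩
      · rw [τ_v b hu, hσ.self b hu, zero_add]
      · rw [v_τ a hu, hσ.self a hu, zero_add, dist_comm]
    · have ha := hσ.tree_verts _ h a (Sym2.mem_mk_left a b)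
      have hb := hσ.tree_verts _ h b (Sym2.mem_mk_right a b)
      rw [τ_old a ha b hb]
      exact hσ.tree_le a b h
  · intro x hx y hy
    rw [Finset.mem_insert] at hx hy
    rcases hx with rfl | hx <;> rcases hy with rfl | hy
    · simp [graphDist_self]
    · rw [τ_v y hy, add_comm, ENNReal.ofReal_add hc (nonneg u hu y hy)]
      exact (graphDist_le_edge_add (b := u) (by simp) y).trans (by gcongr; exact mono u hu y hy)
    · rw [v_τ x hx, ENNReal.ofReal_add (nonneg x hx u hu) hc]
      refine (graphDist_triangle _ x u y).trans (add_le_add (mono x hx u hu) ?_)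
      rw [dist_comm]
      exact graphDist_edge (by simp [Sym2.eq_swap])
    · rw [τ_old x hx y hy]
      exact mono x hx y hy
  · intro h hh
    split_ifs at hh
    · exact Finset.mem_insert_of_mem (hσ.hubs_verts h hh)
    · exact Finset.insert_subset_insert v hσ.hubs_verts hh
  · have old : ∀ h ∈ σ.hubs, ∀ h' ∈ σ.hubs, h ≠ h' →
        3 / 8 * dist h r + 3 / 8 * dist h' r ≤ leafDist σ.treeDist u v (dist v u) h h' := by
      intro h hh h' hh' hne
      rw [τ_old h (hσ.hubs_verts h hh) h' (hσ.hubs_verts h' hh')]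
      exact hσ.hubs_sep h hh h' hh' hne
    split_ifs with hex
    · exact old
    push Not at hex
    have far : ∀ h ∈ σ.hubs, 3 / 8 * dist v r + 3 / 8 * dist h r ≤ σ.treeDist u h + dist v u := by
      intro h hh
      have hhv := hσ.hubs_verts h hh
      have h1 := hex h hh
      rw [τ_v h hhv] at h1
      have h2 := dist_le' h hhv
      have h3 := dist_triangle_left h r v
      linarith [dist_nonneg (x := v) (y := r)]
    intro h hh h' hh' hne
    rw [Finset.mem_insert] at hh hh'
    rcases hh with rfl | hh <;> rcases hh' with rfl | hh'
    · exact absurd rfl hne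
    · rw [τ_v h' (hσ.hubs_verts h' hh')]
      exact far h' hh'
    · rw [v_τ h (hσ.hubs_verts h hh), hσ.symm h (hσ.hubs_verts h hh) u hu, add_comm]
      exact far h hh
    · exact old h hh h' hh' hne
  · intro x hx
    rw [Finset.mem_insert] at hx
    rcases hx with rfl | hx
    · split_ifs with hex
      · exact hex
      · refine ⟨x, Finset.mem_insert_self _ _, ?_⟩
        rw [τ_vv]
        linarith [dist_nonneg (x := x) (y := r)]
    · obtain ⟨h, hh, hle⟩ := hσ.stretch x hx
      refine ⟨h, ?_, ?_⟩
      · split_ifs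
        · exact hh
        · exact Finset.mem_insert_of_mem hh
      · rwa [τ_old x hx h (hσ.hubs_verts h hh)]
  · intro x hx y hy hne
    simp only [erase_eq] at hx hy
    rw [Finset.mem_insert] at hx hy
    rcases hx with rfl | hx <;> rcases hy with rfl | hy
    · exact absurd rfl hne
    · refine (min_le_left _ _).trans ?_
      rw [Function.update_self]
      exact hnear y (Finset.mem_of_mem_erase hy)
    · refine (min_le_right _ _).trans ?_
      rw [Function.update_self, dist_comm x]
      exact hnear x (Finset.mem_of_mem_erase hx)
    · rw [att x (Finset.mem_of_mem_erase hx), att y (Finset.mem_of_mem_erase hy)]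
      exact hσ.attach_sep x hx y hy hne
  · intro x hx
    simp only [erase_eq] at hx
    rw [Finset.mem_insert] at hx
    rcases hx with rfl | hx
    · rw [Function.update_self]
      exact hnear r hσ.root_mem
    · rw [att x (Finset.mem_of_mem_erase hx)]
      exact hσ.attach_root x hx
  · rw [erase_eq, Finset.sum_insert (fun h => hv (Finset.mem_of_mem_erase h)),
      Function.update_self, graphCost,
      Finset.sum_insert (fun h => old_edge _ h v (Sym2.mem_mk_left v u) rfl), edgeLen_mk]
    rw [Finset.sum_congr rfl fun x hx => att x (Finset.mem_of_mem_erase hx)]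
    exact add_le_add_right hσ.cost_le _

lemma Inv.graphDist_edges_le {r : X} {σ : LastState X} (hσ : σ.Inv r) {x : X}
    (hx : x ∈ σ.verts) :
    graphDist (↑(σ.edges r)) x r ≤ ENNReal.ofReal (7 * dist x r) := by
  obtain ⟨h, hh, hle⟩ := hσ.stretch x hx
  have hhv := hσ.hubs_verts h hh
  calc graphDist (↑(σ.edges r)) x r
      ≤ graphDist (↑(σ.edges r)) x h + graphDist (↑(σ.edges r)) h r := graphDist_triangle _ _ _ _
    _ ≤ ENNReal.ofReal (σ.treeDist x h) + ENNReal.ofReal (dist h r) := by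
        refine add_le_add ?_ (graphDist_edge ?_)
        · exact (graphDist_mono (by simp [edges]) x h).trans (hσ.graphDist_le x hx h hhv)
        · exact Finset.mem_union_right _ (Finset.mem_image_of_mem (fun h => s(h, r)) hh)
    _ = ENNReal.ofReal (σ.treeDist x h + dist h r) :=
        (ENNReal.ofReal_add (dist_nonneg.trans (hσ.dist_le x hx h hhv)) dist_nonneg).symm
    _ ≤ ENNReal.ofReal (7 * dist x r) := ENNReal.ofReal_le_ofReal hle

lemma Inv.graphDist_tree_ne_top {r : X} {σ : LastState X} (hσ : σ.Inv r) {x y : X}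
    (hx : x ∈ σ.verts) (hy : y ∈ σ.verts) : graphDist (↑σ.tree) x y ≠ ⊤ :=
  ne_top_of_le_ne_top ENNReal.ofReal_ne_top (hσ.graphDist_le x hx y hy)

/-- The edges to the hubs cost at most a constant times the greedy tree. -/
lemma Inv.graphCost_edges_le {r : X} {σ : LastState X} (hσ : σ.Inv r) :
    graphCost (σ.edges r) ≤ 4 * graphCost σ.tree := by
  have hhub : ∑ h ∈ σ.hubs, 3 / 8 * dist h r ≤ graphCost σ.tree := by
    refine sum_radius_le_graphCost (S := (σ.verts : Set X)) (τ := σ.treeDist) (r := r)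
      hσ.self hσ.symm hσ.tri hσ.hubs_verts hσ.hubs_sep ?_ hσ.tree_verts hσ.tree_le ?_
    · intro h hh
      linarith [hσ.dist_le h (hσ.hubs_verts h hh) r hσ.root_mem, dist_nonneg (x := h) (y := r)]
    · exact fun h hh => hσ.graphDist_tree_ne_top (hσ.hubs_verts h hh) hσ.root_mem
  have himage : ∑ e ∈ σ.hubs.image (fun h => s(h, r)), edgeLen e ≤ ∑ h ∈ σ.hubs, dist h r :=
    Finset.sum_image_le_of_nonneg fun _ _ => edgeLen_nonneg _
  have hunion : graphCost (σ.edges r) ≤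
      graphCost σ.tree + ∑ e ∈ σ.hubs.image (fun h => s(h, r)), edgeLen e := by
    rw [edges, graphCost, graphCost, ← Finset.sum_union_inter]
    exact le_add_of_nonneg_right (Finset.sum_nonneg fun e _ => edgeLen_nonneg e)
  rw [← Finset.mul_sum] at hhub
  have : 0 ≤ graphCost σ.tree := Finset.sum_nonneg fun e _ => edgeLen_nonneg e
  linarith

/-- The greedy tree is logarithmically competitive. -/
lemma Inv.graphCost_tree_le {r : X} {σ : LastState X} (hσ : σ.Inv r) :
    graphCost σ.tree ≤
      2 * (harmonic (σ.verts.erase r).card : ℝ) * mstCost σ.verts := by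
  have key : ∀ T : Finset (Sym2 X),
      (∀ a ∈ σ.verts, ∀ b ∈ σ.verts, graphDist (↑T) a b ≠ ⊤) →
      graphCost σ.tree ≤ 2 * (harmonic (σ.verts.erase r).card : ℝ) * graphCost T := by
    intro T hT
    have := sum_le_harmonic_mul (E := T) _ _ rfl hσ.attach_sep hσ.attach_root
      fun x hx => hT x (Finset.mem_of_mem_erase hx) r hσ.root_mem
    linarith [hσ.cost_le]
  have hne : { c | ∃ T : Finset (Sym2 X), (∀ e ∈ T, ∀ x ∈ e, x ∈ σ.verts) ∧
      (∀ a ∈ σ.verts, ∀ b ∈ σ.verts, graphDist (↑T) a b ≠ ⊤) ∧ c = graphCost T }.Nonempty :=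
    ⟨_, σ.tree, hσ.tree_verts, fun a ha b hb => hσ.graphDist_tree_ne_top ha hb, rfl⟩
  rcases (σ.verts.erase r).eq_empty_or_nonempty with h0 | h0
  · have := hσ.cost_le
    rw [h0] at this ⊢
    simpa using this
  · have hpos : (0 : ℝ) < 2 * (harmonic (σ.verts.erase r).card : ℝ) := by
      have : 0 < harmonic (σ.verts.erase r).card := harmonic_pos h0.card_pos.ne'
      have : (0 : ℝ) < (harmonic (σ.verts.erase r).card : ℝ) := by exact_mod_cast this
      linarith
    rw [mul_comm, ← div_le_iff₀ hpos]
    refine le_csInf hne ?_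
    rintro c ⟨T, -, hT, rfl⟩
    rw [div_le_iff₀ hpos, mul_comm]
    exact key T hT

/-- The state after processing a list of arrivals. -/
def run (r : X) (l : List X) : LastState X :=
  l.foldl (step r) (start r)

lemma run_concat (r : X) (l : List X) (v : X) : run r (l ++ [v]) = (run r l).step r v := by
  simp [run]

lemma inv_run (r : X) (l : List X) : (run r l).Inv r := by
  induction l using List.reverseRecOn with
  | nil => exact inv_start r
  | append_singleton l v ih =>
    rw [run_concat]
    exact inv_step ih v

lemma verts_run (r : X) (l : List X) : (run r l).verts = insert r l.toFinset := by
  induction l using List.reverseRecOn with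
  | nil => simp [run, start]
  | append_singleton l v ih =>
    rw [run_concat, verts_step, ih]
    ext
    simp
    tauto

lemma edges_run_subset (r : X) (l l' : List X) :
    (run r l).edges r ⊆ (run r (l ++ l')).edges r := by
  induction l' using List.reverseRecOn with
  | nil => simp
  | append_singleton l' v ih =>
    rw [← List.append_assoc, run_concat]
    exact ih.trans (edges_subset_step r _ v)

end LastState

lemma mstCost_nonneg (S : Finset X) : 0 ≤ mstCost S := by
  refine Real.sInf_nonneg ?_
  rintro c ⟨T, -, -, rfl⟩
  exact Finset.sum_nonneg fun e _ => edgeLen_nonneg e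

lemma harmonic_le_one_add_logb {n k : ℕ} (hk : 1 ≤ k) (hnk : n ≤ k) :
    (harmonic n : ℝ) ≤ 1 + Real.logb 2 k := by
  have hk' : (1 : ℝ) ≤ k := by exact_mod_cast hk
  have hlog : 0 ≤ Real.log k := Real.log_nonneg hk'
  have h2 : Real.log k ≤ Real.logb 2 k := by
    rw [Real.logb, le_div_iff₀ (Real.log_pos one_lt_two)]
    nlinarith [Real.log_two_lt_d9]
  rcases n.eq_zero_or_pos with rfl | hn
  · simpa using by linarith
  have h3 : Real.log n ≤ Real.log k :=
    Real.log_le_log (by exact_mod_cast hn) (by exact_mod_cast hnk)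
  linarith [harmonic_le_one_add_log n]

/-- **Theorem 4 (Online LAST).**
There is a universal constant `C` such that for every metric space `X` and sink
`r` there is an online algorithm maintaining a monotonically growing set of edges
such that after any sequence of `k ≥ 1` terminals: (i) every terminal is within
graph distance `7` times its metric distance to the sink, and (ii) the total cost
is at most `C·(1 + log₂ k)` times the minimum spanning tree on the terminals and
the sink. -/
theorem online_LAST :
    ∃ C : ℝ, 0 < C ∧
      ∀ (X : Type) [MetricSpace X] (r : X),
        ∃ A : List X → Finset (Sym2 X),
          -- online: the edge set only grows as terminals arrive
          (∀ l l' : List X, A l ⊆ A (l ++ l')) ∧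
          ∀ (k : ℕ), 1 ≤ k → ∀ v : Fin k → X,
            -- (i) stretch 7 from every terminal to the sink
            (∀ s : Fin k,
              graphDist (↑(A (List.ofFn v))) (v s) r
                ≤ ENNReal.ofReal (7 * dist (v s) r)) ∧
            -- (ii) cost at most C·(1 + log₂ k) times the MST on {r, v₁, …, v_k}
            graphCost (A (List.ofFn v))
              ≤ C * (1 + Real.logb 2 (k : ℝ)) *
                  mstCost (insert r (Finset.image v Finset.univ)) := by
  refine ⟨8, by norm_num, fun X _ r => ⟨fun l => (LastState.run r l).edges r,
    LastState.edges_run_subset r, fun k hk v => ?_⟩⟩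
  have hinv := LastState.inv_run r (List.ofFn v)
  have hverts : (LastState.run r (List.ofFn v)).verts =
      insert r (Finset.image v Finset.univ) := by
    rw [LastState.verts_run]
    ext
    simp [List.mem_ofFn]
  refine ⟨fun s => hinv.graphDist_edges_le (by simp [hverts]), ?_⟩
  have hcard : ((LastState.run r (List.ofFn v)).verts.erase r).card ≤ k := by
    rw [hverts, Finset.erase_insert_eq_erase]
    exact (Finset.card_le_card (Finset.erase_subset _ _)).trans
      (Finset.card_image_le.trans (by simp))
  have hcost := hinv.graphCost_edges_le
  have htree := hinv.graphCost_tree_le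
  have hmul := mul_le_mul_of_nonneg_right (harmonic_le_one_add_logb hk hcard)
    (mstCost_nonneg (insert r (Finset.image v Finset.univ)))
  rw [hverts] at htree hmul
  linarith
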